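/- Let g, h : ℝⁿ → ℝ be twice continuously differentiable on an open set U ⊆ ℝⁿ and let B ⊆ U. Let L_g ⊊ L_h ⊊ {1,…,n} be index sets such that g depends at most linearly on x_i for all i ∈ L_g and h depends at most linearly on x_i for all i ∈ L_h. Suppose every eigenvalue of ∇²_{L_gᶜ} g(x) lies in [λ̲_g, λ̄_g] and every eigenvalue of ∇²_{L_hᶜ} h(x) lies in [λ̲_h, λ̄_h], for every x ∈ B. Then for every x ∈ B every eigenvalue of the reduced Hessian ∇²_{L_gᶜ}(g+h)(x) lies in the interval [λ̲_g + min{λ̲_h, 0}, λ̄_g + max{λ̄_h, 0}]. -/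

import Mathlib

open scoped BigOperators

/-- First partial derivative `∂f/∂x_i (x)`. -/
noncomputable def pd {n : ℕ} (f : (Fin n → ℝ) → ℝ) (i : Fin n) (x : Fin n → ℝ) : ℝ :=
  fderiv ℝ f x (Pi.single i 1)

/-- Second partial derivative `∂²f/∂x_i∂x_j (x)` (differentiate w.r.t. `x_j` first, then `x_i`). -/
noncomputable def pd2 {n : ℕ} (f : (Fin n → ℝ) → ℝ) (i j : Fin n) (x : Fin n → ℝ) : ℝ :=
  pd (fun y => pd f j y) i x

/-- Hessian matrix `∇²f(x)` with entries `(∇²f(x))_{ij} = ∂²f/∂x_i∂x_j (x)`. -/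
noncomputable def hess {n : ℕ} (f : (Fin n → ℝ) → ℝ) (x : Fin n → ℝ) :
    Matrix (Fin n) (Fin n) ℝ :=
  Matrix.of fun i j => pd2 f i j x

/-- Reduced Hessian `∇²_J f(x)` indexed by the elements of `J` in ascending order. -/
noncomputable def redHess {n : ℕ} (f : (Fin n → ℝ) → ℝ) (J : Finset (Fin n)) (x : Fin n → ℝ) :
    Matrix (Fin J.card) (Fin J.card) ℝ :=
  Matrix.of fun i j => pd2 f (J.orderIsoOfFin rfl i).1 (J.orderIsoOfFin rfl j).1 x

/-- Every eigenvalue of the (symmetric) matrix `M` lies in `[lo, hi]`. -/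
def eigsIn {m : ℕ} (M : Matrix (Fin m) (Fin m) ℝ) (lo hi : ℝ) : Prop :=
  ∀ (μ : ℝ) (v : Fin m → ℝ), v ≠ 0 → M.mulVec v = μ • v → lo ≤ μ ∧ μ ≤ hi

/-- A second partial derivative is a value of the second Fréchet derivative. -/
theorem pd2_eq_fderiv_fderiv {n : ℕ} {f : (Fin n → ℝ) → ℝ} {x : Fin n → ℝ}
    (hf : ContDiffAt ℝ 2 f x) (i j : Fin n) :
    pd2 f i j x = fderiv ℝ (fderiv ℝ f) x (Pi.single i 1) (Pi.single j 1) := by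
  have hd : DifferentiableAt ℝ (fderiv ℝ f) x :=
    (hf.fderiv_right (m := 1) (by norm_num)).differentiableAt (by norm_num)
  simp only [pd2, pd]
  rw [fderiv_clm_apply hd (differentiableAt_const _)]
  simp

/-- Second partial derivatives of a `C²` function commute. -/
theorem pd2_comm {n : ℕ} {f : (Fin n → ℝ) → ℝ} {x : Fin n → ℝ}
    (hf : ContDiffAt ℝ 2 f x) (i j : Fin n) : pd2 f i j x = pd2 f j i x := by
  rw [pd2_eq_fderiv_fderiv hf, pd2_eq_fderiv_fderiv hf]
  exact (hf.isSymmSndFDerivAt (by simp)).eq _ _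

/-- Second partial derivatives of `C²` functions are additive. -/
theorem pd2_add {n : ℕ} {f g : (Fin n → ℝ) → ℝ} {x : Fin n → ℝ}
    (hf : ContDiffAt ℝ 2 f x) (hg : ContDiffAt ℝ 2 g x) (i j : Fin n) :
    pd2 (fun y => f y + g y) i j x = pd2 f i j x + pd2 g i j x := by
  have hdf : DifferentiableAt ℝ (fderiv ℝ f) x :=
    (hf.fderiv_right (m := 1) (by norm_num)).differentiableAt (by norm_num)
  have hdg : DifferentiableAt ℝ (fderiv ℝ g) x :=
    (hg.fderiv_right (m := 1) (by norm_num)).differentiableAt (by norm_num)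
  have hev : fderiv ℝ (fun y => f y + g y) =ᶠ[nhds x] fun y => fderiv ℝ f y + fderiv ℝ g y := by
    filter_upwards [hf.eventually (by simp), hg.eventually (by simp)] with y hfy hgy
    exact fderiv_fun_add (hfy.differentiableAt (by norm_num)) (hgy.differentiableAt (by norm_num))
  rw [pd2_eq_fderiv_fderiv hf, pd2_eq_fderiv_fderiv hg, pd2_eq_fderiv_fderiv (hf.add hg),
    hev.fderiv_eq, fderiv_fun_add hdf hdg]
  rfl

/-- Differentiating a locally constant partial derivative gives zero. -/
theorem pd2_eq_zero_of_pd_const {n : ℕ} {f : (Fin n → ℝ) → ℝ} {U : Set (Fin n → ℝ)}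
    (hU : IsOpen U) {x : Fin n → ℝ} (hx : x ∈ U) {j : Fin n} {c : ℝ}
    (hc : ∀ y ∈ U, pd f j y = c) (i : Fin n) : pd2 f i j x = 0 := by
  have hev : (fun y => pd f j y) =ᶠ[nhds x] fun _ => c := by
    filter_upwards [hU.mem_nhds hx] with y hy using hc y hy
  rw [pd2, pd, hev.fderiv_eq]
  simp

theorem redHess_isSymm {n : ℕ} {f : (Fin n → ℝ) → ℝ} {x : Fin n → ℝ}
    (hf : ContDiffAt ℝ 2 f x) (J : Finset (Fin n)) : (redHess f J x).IsSymm :=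
  Matrix.IsSymm.ext fun _ _ => pd2_comm hf _ _

/-- The sum of `F` over `J`, enumerated in ascending order. -/
theorem sum_orderIsoOfFin {n : ℕ} (J : Finset (Fin n)) (F : Fin n → ℝ) :
    ∑ k, F (J.orderIsoOfFin rfl k).1 = ∑ i ∈ J, F i := by
  rw [← Finset.sum_coe_sort J F]
  exact (J.orderIsoOfFin rfl).toEquiv.sum_comp fun i : J => F i

/-- The quadratic form of a reduced Hessian, as a sum over the index set. -/
theorem dotProduct_redHess_mulVec {n : ℕ} (f : (Fin n → ℝ) → ℝ) (J : Finset (Fin n))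
    (x w : Fin n → ℝ) :
    (fun k => w (J.orderIsoOfFin rfl k).1) ⬝ᵥ
        (redHess f J x).mulVec (fun k => w (J.orderIsoOfFin rfl k).1) =
      ∑ i ∈ J, w i * ∑ j ∈ J, pd2 f i j x * w j := by
  rw [← sum_orderIsoOfFin J]
  refine Finset.sum_congr rfl fun k _ => ?_
  rw [← sum_orderIsoOfFin J]
  rfl

theorem le_quadratic_of_le_eigenvalues {m : ℕ} {M : Matrix (Fin m) (Fin m) ℝ}
    (hM : M.IsSymm) {lo : ℝ}
    (h : ∀ (μ : ℝ) (v : Fin m → ℝ), v ≠ 0 → M.mulVec v = μ • v → lo ≤ μ) (v : Fin m → ℝ) :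
    lo * (v ⬝ᵥ v) ≤ v ⬝ᵥ M.mulVec v := by
  have hH : (M - lo • (1 : Matrix (Fin m) (Fin m) ℝ)).IsHermitian := by
    rw [Matrix.IsHermitian, Matrix.conjTranspose_eq_transpose_of_trivial]
    simp [Matrix.transpose_sub, hM.eq]
  have hpos : (M - lo • (1 : Matrix (Fin m) (Fin m) ℝ)).PosSemidef := by
    rw [hH.posSemidef_iff_eigenvalues_nonneg]
    intro i
    have he := hH.mulVec_eigenvectorBasis i
    rw [Matrix.sub_mulVec, Matrix.smul_mulVec, Matrix.one_mulVec, sub_eq_iff_eq_add,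
      ← add_smul] at he
    have hne : (hH.eigenvectorBasis i).ofLp ≠ 0 := fun h0 =>
      hH.eigenvectorBasis.orthonormal.ne_zero i ((WithLp.ofLp_eq_zero 2).1 h0)
    have := h _ _ hne he
    simpa using this
  have := hpos.dotProduct_mulVec_nonneg v
  simp only [star_trivial, Matrix.sub_mulVec, Matrix.smul_mulVec, Matrix.one_mulVec,
    dotProduct_sub, dotProduct_smul, smul_eq_mul] at this
  linarith

/-- The eigenvalues of a symmetric matrix bound its quadratic form. -/
theorem eigsIn.quadratic_mem {m : ℕ} {M : Matrix (Fin m) (Fin m) ℝ} {lo hi : ℝ}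
    (h : eigsIn M lo hi) (hM : M.IsSymm) (v : Fin m → ℝ) :
    lo * (v ⬝ᵥ v) ≤ v ⬝ᵥ M.mulVec v ∧ v ⬝ᵥ M.mulVec v ≤ hi * (v ⬝ᵥ v) := by
  refine ⟨le_quadratic_of_le_eigenvalues hM (fun μ v hv e => (h μ v hv e).1) v, ?_⟩
  have := le_quadratic_of_le_eigenvalues (M := -M) (lo := -hi) hM.neg
    (fun μ v hv e => neg_le.1 (h (-μ) v hv (by
      rw [Matrix.neg_mulVec] at e
      rw [neg_smul, ← e, neg_neg])).2) v
  rw [Matrix.neg_mulVec, dotProduct_neg] at this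
  linarith

/-- Bounds on the quadratic form bound the eigenvalues. -/
theorem eigsIn_of_quadratic_mem {m : ℕ} {M : Matrix (Fin m) (Fin m) ℝ} {lo hi : ℝ}
    (h : ∀ v : Fin m → ℝ,
      lo * (v ⬝ᵥ v) ≤ v ⬝ᵥ M.mulVec v ∧ v ⬝ᵥ M.mulVec v ≤ hi * (v ⬝ᵥ v)) :
    eigsIn M lo hi := by
  intro μ v hv e
  have hpos : 0 < v ⬝ᵥ v :=
    lt_of_le_of_ne (Finset.sum_nonneg fun i _ => mul_self_nonneg (v i))
      fun h0 => hv (dotProduct_self_eq_zero.1 h0.symm)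
  have hb := h v
  rw [e, dotProduct_smul, smul_eq_mul] at hb
  exact ⟨le_of_mul_le_mul_right hb.1 hpos, le_of_mul_le_mul_right hb.2 hpos⟩

theorem stmt8 {n : ℕ} (hn : 0 < n) (U B : Set (Fin n → ℝ)) (hU : IsOpen U) (hBU : B ⊆ U)
    (g h : (Fin n → ℝ) → ℝ) (hg : ContDiffOn ℝ 2 g U) (hh : ContDiffOn ℝ 2 h U)
    (Lg Lh : Finset (Fin n)) (hgh : Lg ⊂ Lh) (hLh : Lh ⊂ Finset.univ)
    (hling : ∀ i ∈ Lg, ∃ c : ℝ, ∀ x ∈ U, pd g i x = c)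
    (hlinh : ∀ i ∈ Lh, ∃ c : ℝ, ∀ x ∈ U, pd h i x = c)
    (glo ghi hlo hhi : ℝ) (hgI : glo ≤ ghi) (hhI : hlo ≤ hhi)
    (hgB : ∀ x ∈ B, eigsIn (redHess g Lgᶜ x) glo ghi)
    (hhB : ∀ x ∈ B, eigsIn (redHess h Lhᶜ x) hlo hhi) :
    ∀ x ∈ B, eigsIn (redHess (fun y => g y + h y) Lgᶜ x)
      (glo + min hlo 0) (ghi + max hhi 0) := by
  intro x hx
  have hxU := hBU hx
  have hgx : ContDiffAt ℝ 2 g x := hg.contDiffAt (hU.mem_nhds hxU)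
  have hhx : ContDiffAt ℝ 2 h x := hh.contDiffAt (hU.mem_nhds hxU)
  have hsub : Lhᶜ ⊆ Lgᶜ := Finset.compl_subset_compl.2 hgh.subset
  have hcol : ∀ i, ∀ j ∈ Lh, pd2 h i j x = 0 := fun i j hj => by
    obtain ⟨c, hc⟩ := hlinh j hj
    exact pd2_eq_zero_of_pd_const hU hxU hc i
  refine eigsIn_of_quadratic_mem fun v => ?_
  obtain ⟨w, rfl⟩ : ∃ w : Fin n → ℝ, v = fun k => w (Lgᶜ.orderIsoOfFin rfl k).1 :=
    ⟨fun i => if hi : i ∈ Lgᶜ then v ((Lgᶜ.orderIsoOfFin rfl).symm ⟨i, hi⟩) else 0, by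
      ext k
      beta_reduce
      rw [dif_pos (Lgᶜ.orderIsoOfFin rfl k).2]
      simp only [Subtype.coe_eta, OrderIso.symm_apply_apply]⟩
  have hnorm : ∀ J : Finset (Fin n), (fun k => w (J.orderIsoOfFin rfl k).1) ⬝ᵥ
      (fun k => w (J.orderIsoOfFin rfl k).1) = ∑ i ∈ J, w i * w i :=
    fun J => sum_orderIsoOfFin J fun i => w i * w i
  have hG := (hgB x hx).quadratic_mem (redHess_isSymm hgx _)
    (fun k => w (Lgᶜ.orderIsoOfFin rfl k).1)
  have hH := (hhB x hx).quadratic_mem (redHess_isSymm hhx _)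
    (fun k => w (Lhᶜ.orderIsoOfFin rfl k).1)
  rw [dotProduct_redHess_mulVec, hnorm] at hG hH ⊢
  have hext : ∑ i ∈ Lhᶜ, w i * ∑ j ∈ Lhᶜ, pd2 h i j x * w j =
      ∑ i ∈ Lgᶜ, w i * ∑ j ∈ Lgᶜ, pd2 h i j x * w j := by
    have hinner : ∀ i, ∑ j ∈ Lhᶜ, pd2 h i j x * w j = ∑ j ∈ Lgᶜ, pd2 h i j x * w j := fun i =>
      Finset.sum_subset hsub fun j _ hj => by
        rw [hcol i j (by simpa using hj), zero_mul]
    simp only [hinner]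
    refine Finset.sum_subset hsub fun i _ hi => ?_
    rw [Finset.sum_eq_zero fun j _ => by
      rw [pd2_comm hhx, hcol j i (by simpa using hi), zero_mul], mul_zero]
  have hadd : ∑ i ∈ Lgᶜ, w i * ∑ j ∈ Lgᶜ, pd2 (fun y => g y + h y) i j x * w j =
      (∑ i ∈ Lgᶜ, w i * ∑ j ∈ Lgᶜ, pd2 g i j x * w j) +
        ∑ i ∈ Lgᶜ, w i * ∑ j ∈ Lgᶜ, pd2 h i j x * w j := by
    simp only [pd2_add hgx hhx, add_mul, mul_add, Finset.sum_add_distrib]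
  have h_nonneg : 0 ≤ ∑ i ∈ Lhᶜ, w i * w i := Finset.sum_nonneg fun i _ => mul_self_nonneg (w i)
  have h_le : ∑ i ∈ Lhᶜ, w i * w i ≤ ∑ i ∈ Lgᶜ, w i * w i :=
    Finset.sum_le_sum_of_subset_of_nonneg hsub fun i _ _ => mul_self_nonneg (w i)
  have h_lo : min hlo 0 * ∑ i ∈ Lgᶜ, w i * w i ≤ hlo * ∑ i ∈ Lhᶜ, w i * w i :=
    (mul_le_mul_of_nonpos_left h_le (min_le_right _ _)).trans
      (mul_le_mul_of_nonneg_right (min_le_left _ _) h_nonneg)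
  have h_hi : hhi * ∑ i ∈ Lhᶜ, w i * w i ≤ max hhi 0 * ∑ i ∈ Lgᶜ, w i * w i :=
    (mul_le_mul_of_nonneg_right (le_max_left _ _) h_nonneg).trans
      (mul_le_mul_of_nonneg_left h_le (le_max_right _ _))
  rw [hadd, ← hext, add_mul, add_mul]
  exact ⟨add_le_add hG.1 (h_lo.trans hH.1), add_le_add hG.2 (hH.2.trans h_hi)⟩
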